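/- arXiv:2007.14778 — 4 statements merged into one kernel-verified Lean document; each statement's English description precedes it below -/
import Mathlib

section
/- Let S be a finite nonempty set (a sample of weight vectors), and for each w ∈ S let f_w : X → ℝ be a function on a set X with f_w(z) ∈ [0, 1] for all z ∈ X. Fix x, y ∈ X. If b : S → ℝ satisfies, for every w ∈ S, b(w) ∈ {0, 1}, b(w) ≤ f_w(y) − f_w(x) + 1, and b(w) ≥ f_w(y) − f_w(x), then (1/|S|) Σ_{w∈S} b(w)·(f_w(y) − f_w(x)) = PER(x, y, S), where PER(x, y, S) = (1/|S|) Σ_{w∈S} max{0, f_w(y) − f_w(x)}. -/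
/-- Any feasible assignment of the binary variables `b_w` for the constraints `(c_≤)` and
`(c_≥)` of program `P_MER` yields the objective value `PER(x, y, S)`. -/
theorem stmt_3 {X S : Type*} [Fintype S] [Nonempty S]
    (f : S → X → ℝ) (hf : ∀ w : S, ∀ z : X, f w z ∈ Set.Icc (0 : ℝ) 1)
    (x y : X) (b : S → ℝ)
    (hb01 : ∀ w : S, b w = 0 ∨ b w = 1)
    (hble : ∀ w : S, b w ≤ f w y - f w x + 1)
    (hbge : ∀ w : S, b w ≥ f w y - f w x) :
    (1 / (Fintype.card S : ℝ)) * ∑ w : S, b w * (f w y - f w x)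
      = (1 / (Fintype.card S : ℝ)) * ∑ w : S, max 0 (f w y - f w x) := by
  congr 1
  refine Finset.sum_congr rfl fun w _ => ?_
  have hle := hble w
  have hge := hbge w
  rcases hb01 w with h | h <;> rw [h] at hle hge ⊢
  · rw [zero_mul, max_eq_left hge]
  · rw [one_mul, max_eq_right (by linarith)]
end

section
/- Let X be a finite nonempty set, S a finite nonempty set, and for each w ∈ S let f_w : X → ℝ. Define PER(x, y, S) = (1/|S|) Σ_{w∈S} max{0, f_w(y) − f_w(x)}, MER(x, B, S) = max_{y∈B} PER(x, y, S) for nonempty B ⊆ X, and MMER(X, S) = min_{x∈X} MER(x, X, S). Let A ⊆ X be nonempty, let x_A ∈ X minimize MER(·, A, S) over X (i.e., MER(x_A, A, S) ≤ MER(x, A, S) for all x ∈ X), and let ŷ ∈ X be a best challenger of x_A over X (i.e., PER(x_A, ŷ, S) = MER(x_A, X, S)). If ŷ ∈ A, then MER(x_A, A, S) = MER(x_A, X, S) = MMER(X, S); that is, when the stopping condition of Algorithm 1 is met, x_A is a minimax expected regret solution over X. -/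
/-- If `a` minimizes `x ↦ max_{y ∈ A} r x y` and the maximum of `r a` over the whole type is attained
at a point of `A`, then `a` attains the minimax value of `r` over the whole type. -/
theorem sup'_eq_and_eq_inf'_sup'_of_mem {X α : Type*} [Fintype X] [Nonempty X] [LinearOrder α]
    (r : X → X → α) {A : Finset X} (hA : A.Nonempty) {a b : X}
    (ha : ∀ x, A.sup' hA (r a) ≤ A.sup' hA (r x))
    (hb : r a b = Finset.univ.sup' Finset.univ_nonempty (r a)) (hmem : b ∈ A) :
    A.sup' hA (r a) = Finset.univ.sup' Finset.univ_nonempty (r a) ∧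
      Finset.univ.sup' Finset.univ_nonempty (r a) =
        Finset.univ.inf' Finset.univ_nonempty
          (fun x => Finset.univ.sup' Finset.univ_nonempty (r x)) := by
  have hmono (x : X) : A.sup' hA (r x) ≤ Finset.univ.sup' Finset.univ_nonempty (r x) :=
    Finset.sup'_mono _ A.subset_univ hA
  have heq : A.sup' hA (r a) = Finset.univ.sup' Finset.univ_nonempty (r a) :=
    (hmono a).antisymm (hb ▸ Finset.le_sup' (r a) hmem)
  refine ⟨heq, le_antisymm ?_ (Finset.inf'_le _ (Finset.mem_univ a))⟩
  exact Finset.le_inf' _ _ fun x _ => heq ▸ (ha x).trans (hmono x)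

/-- Proposition 3 (validity of the constraint-generation algorithm): if `x_A` minimizes
`MER(·, A, S)` over `X`, `ŷ` is a best challenger of `x_A` over `X`, and `ŷ ∈ A`, then
`MER(x_A, A, S) = MER(x_A, X, S) = MMER(X, S)`. -/
theorem stmt_9 {X S : Type*} [Fintype X] [Nonempty X] [Fintype S] [Nonempty S]
    (f : S → X → ℝ) (A : Finset X) (hA : A.Nonempty) (xA yhat : X)
    (hxA : ∀ x : X,
      A.sup' hA (fun y => (1 / (Fintype.card S : ℝ)) * ∑ w : S, max 0 (f w y - f w xA))
        ≤ A.sup' hA (fun y => (1 / (Fintype.card S : ℝ)) * ∑ w : S, max 0 (f w y - f w x)))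
    (hyhat : (1 / (Fintype.card S : ℝ)) * ∑ w : S, max 0 (f w yhat - f w xA)
      = Finset.univ.sup' Finset.univ_nonempty
          (fun y : X => (1 / (Fintype.card S : ℝ)) * ∑ w : S, max 0 (f w y - f w xA)))
    (hmem : yhat ∈ A) :
    A.sup' hA (fun y => (1 / (Fintype.card S : ℝ)) * ∑ w : S, max 0 (f w y - f w xA))
        = Finset.univ.sup' Finset.univ_nonempty
          (fun y : X => (1 / (Fintype.card S : ℝ)) * ∑ w : S, max 0 (f w y - f w xA)) ∧
    Finset.univ.sup' Finset.univ_nonempty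
          (fun y : X => (1 / (Fintype.card S : ℝ)) * ∑ w : S, max 0 (f w y - f w xA))
        = Finset.univ.inf' Finset.univ_nonempty
          (fun x : X => Finset.univ.sup' Finset.univ_nonempty
            (fun y : X => (1 / (Fintype.card S : ℝ)) * ∑ w : S, max 0 (f w y - f w x))) := by
  exact sup'_eq_and_eq_inf'_sup'_of_mem
    (fun x y => (1 / (Fintype.card S : ℝ)) * ∑ w : S, max 0 (f w y - f w x)) hA hxA hyhat hmem
end

section
/- Let X be a finite nonempty set, S a finite nonempty set, and for each w ∈ S let f_w : X → ℝ with f_w(z) ∈ [0, 1] for all z ∈ X. Fix x ∈ X and t ∈ ℝ. Then the following are equivalent: (i) for every y ∈ X and every b : S → ℝ satisfying, for all w ∈ S, b(w) ∈ {0, 1}, b(w) ≤ f_w(y) − f_w(x) + 1, and b(w) ≥ f_w(y) − f_w(x), one has t ≥ (1/|S|) Σ_{w∈S} b(w)·(f_w(y) − f_w(x)); (ii) t ≥ MER(x, X, S), where MER(x, X, S) = max_{y∈X} (1/|S|) Σ_{w∈S} max{0, f_w(y) − f_w(x)}. -/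
/-- Characterization of the feasible region of the program `P_MMER`: `t` satisfies all the
linearized regret constraints for every challenger `y ∈ X` and every feasible binary
assignment `b` iff `t ≥ MER(x, X, S)`. -/
theorem stmt_10 {X S : Type*} [Fintype X] [Nonempty X] [Fintype S] [Nonempty S]
    (f : S → X → ℝ) (hf : ∀ w : S, ∀ z : X, f w z ∈ Set.Icc (0 : ℝ) 1)
    (x : X) (t : ℝ) :
    (∀ y : X, ∀ b : S → ℝ,
        (∀ w : S, b w = 0 ∨ b w = 1) →
        (∀ w : S, b w ≤ f w y - f w x + 1) →
        (∀ w : S, b w ≥ f w y - f w x) →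
        t ≥ (1 / (Fintype.card S : ℝ)) * ∑ w : S, b w * (f w y - f w x)) ↔
    t ≥ Finset.univ.sup' Finset.univ_nonempty
        (fun y : X => (1 / (Fintype.card S : ℝ)) * ∑ w : S, max 0 (f w y - f w x)) := by
  simp only [ge_iff_le, Finset.sup'_le_iff, Finset.mem_univ, true_implies]
  refine forall_congr' fun y => ⟨fun h => ?_, fun h b hb _ _ => le_trans ?_ h⟩
  · have key := h (fun w => if 0 < f w y - f w x then 1 else 0)
      (fun w => (ite_eq_or_eq _ _ _).symm) (fun w => ?_) (fun w => ?_)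
    · refine le_of_eq_of_le (congrArg _ (Finset.sum_congr rfl fun w _ => ?_)) key
      split_ifs with hd
      · rw [one_mul, max_eq_right hd.le]
      · rw [zero_mul, max_eq_left (not_lt.mp hd)]
    all_goals
      obtain ⟨hx₀, hx₁⟩ := hf w x
      obtain ⟨hy₀, hy₁⟩ := hf w y
      split_ifs <;> linarith
  · gcongr with w
    rcases hb w with hw | hw <;> simp [hw]
end

section
/- Let X be a finite nonempty set, S a finite nonempty set, and for each w ∈ S let f_w : X → ℝ with f_w(z) ∈ [0, 1] for all z ∈ X. Consider the optimization problem: minimize t over pairs (t, x) ∈ ℝ × X such that for every y ∈ X and every b : S → ℝ satisfying, for all w ∈ S, b(w) ∈ {0, 1}, b(w) ≤ f_w(y) − f_w(x) + 1, and b(w) ≥ f_w(y) − f_w(x), it holds that t ≥ (1/|S|) Σ_{w∈S} b(w)·(f_w(y) − f_w(x)). Then the optimal value t* of this problem equals MMER(X, S) = min_{x∈X} max_{y∈X} (1/|S|) Σ_{w∈S} max{0, f_w(y) − f_w(x)}, and any x* appearing in an optimal pair satisfies MER(x*, X, S) = MMER(X, S). -/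
/-- A binary variable `b` with `d ≤ b ≤ d + 1` selects the positive part of `d`. -/
theorem binary_mul_eq_posPart {b d : ℝ} (hb : b = 0 ∨ b = 1) (hle : b ≤ d + 1) (hge : d ≤ b) :
    b * d = max 0 d := by
  rcases hb with rfl | rfl
  · rw [zero_mul, max_eq_left hge]
  · rw [one_mul, max_eq_right (by linarith)]

/-- A number in `[-1, 1]` admits a binary variable `b` with `d ≤ b ≤ d + 1`. -/
theorem exists_binary_between {d : ℝ} (hd : d ∈ Set.Icc (-1 : ℝ) 1) :
    ∃ b : ℝ, (b = 0 ∨ b = 1) ∧ b ≤ d + 1 ∧ d ≤ b := by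
  obtain ⟨h₁, h₂⟩ := hd
  rcases le_total d 0 with h | h
  · exact ⟨0, Or.inl rfl, by linarith, h⟩
  · exact ⟨1, Or.inr rfl, by linarith, h₂⟩

/-- A family of binary variables bounding `c * ∑ w, b w * d w` bounds exactly the weighted sum of
positive parts of `d`. -/
theorem forall_binary_sum_le_iff {S : Type*} [Fintype S] {d : S → ℝ}
    (hd : ∀ w, d w ∈ Set.Icc (-1 : ℝ) 1) (c t : ℝ) :
    (∀ b : S → ℝ, (∀ w, b w = 0 ∨ b w = 1) → (∀ w, b w ≤ d w + 1) → (∀ w, b w ≥ d w) →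
      t ≥ c * ∑ w, b w * d w) ↔ c * ∑ w, max 0 (d w) ≤ t := by
  have key : ∀ b : S → ℝ, (∀ w, b w = 0 ∨ b w = 1) → (∀ w, b w ≤ d w + 1) →
      (∀ w, b w ≥ d w) → ∑ w, b w * d w = ∑ w, max 0 (d w) := fun b hb hle hge =>
    Finset.sum_congr rfl fun w _ => binary_mul_eq_posPart (hb w) (hle w) (hge w)
  constructor
  · intro h
    choose b hb hle hge using fun w => exists_binary_between (hd w)
    exact key b hb hle hge ▸ h b hb hle hge
  · intro h b hb hle hge
    rw [key b hb hle hge]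
    exact h

/-- Proposition 2 (correctness of the program `P_MMER`): the optimal value of the mixed
integer program equals `MMER(X, S)`, and any `x*` appearing in an optimal pair satisfies
`MER(x*, X, S) = MMER(X, S)`. -/
theorem stmt_11 {X S : Type*} [Fintype X] [Nonempty X] [Fintype S] [Nonempty S]
    (f : S → X → ℝ) (hf : ∀ w : S, ∀ z : X, f w z ∈ Set.Icc (0 : ℝ) 1)
    (Feasible : ℝ → X → Prop)
    (hFeasible : ∀ t : ℝ, ∀ x : X, Feasible t x ↔
      (∀ y : X, ∀ b : S → ℝ,
        (∀ w : S, b w = 0 ∨ b w = 1) →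
        (∀ w : S, b w ≤ f w y - f w x + 1) →
        (∀ w : S, b w ≥ f w y - f w x) →
        t ≥ (1 / (Fintype.card S : ℝ)) * ∑ w : S, b w * (f w y - f w x)))
    (mmer : ℝ)
    (hmmer : mmer = Finset.univ.inf' Finset.univ_nonempty
        (fun x : X => Finset.univ.sup' Finset.univ_nonempty
          (fun y : X => (1 / (Fintype.card S : ℝ)) * ∑ w : S, max 0 (f w y - f w x)))) :
    IsLeast {t : ℝ | ∃ x : X, Feasible t x} mmer ∧
    (∀ t : ℝ, ∀ x : X, Feasible t x → t = mmer →
      Finset.univ.sup' Finset.univ_nonempty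
          (fun y : X => (1 / (Fintype.card S : ℝ)) * ∑ w : S, max 0 (f w y - f w x))
        = mmer) := by
  have feasible_iff : ∀ t x, Feasible t x ↔
      Finset.univ.sup' Finset.univ_nonempty
        (fun y : X => (1 / (Fintype.card S : ℝ)) * ∑ w : S, max 0 (f w y - f w x)) ≤ t := by
    intro t x
    rw [hFeasible, Finset.sup'_le_iff]
    simp only [Finset.mem_univ, true_implies]
    refine forall_congr' fun y => forall_binary_sum_le_iff (fun w => ?_) _ _
    have hy := hf w y
    have hx := hf w x
    exact ⟨by linarith [hy.1, hx.2], by linarith [hy.2, hx.1]⟩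
  have mmer_le : ∀ x : X, mmer ≤ Finset.univ.sup' Finset.univ_nonempty
      (fun y : X => (1 / (Fintype.card S : ℝ)) * ∑ w : S, max 0 (f w y - f w x)) := fun x =>
    hmmer ▸ Finset.inf'_le _ (Finset.mem_univ x)
  refine ⟨⟨?_, ?_⟩, ?_⟩
  · obtain ⟨x, -, hx⟩ := Finset.exists_mem_eq_inf' Finset.univ_nonempty
      (fun x : X => Finset.univ.sup' Finset.univ_nonempty
        (fun y : X => (1 / (Fintype.card S : ℝ)) * ∑ w : S, max 0 (f w y - f w x)))
    exact ⟨x, (feasible_iff _ _).2 (hmmer.trans hx).ge⟩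
  · rintro t ⟨x, hx⟩
    exact (mmer_le x).trans ((feasible_iff t x).1 hx)
  · rintro t x hx rfl
    exact le_antisymm ((feasible_iff _ x).1 hx) (mmer_le x)
end
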